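/- arXiv:2504.00363 — 4 statements merged into one kernel-verified Lean document; each statement's English description precedes it below -/
import Mathlib

section
/- Let q be a prime power, n ≥ 1 and d ≥ 1 integers, let R = Mat_{n×n}(𝔽_q), and let t ∈ R be a unit. Then #{(x, y) ∈ R^d × R^d : x·y = t} ≥ (1/4)·|R|^{2d−1}. -/
open Finset
open scoped Classical

/-- The dot product `x·y = x₁y₁ + ⋯ + x_d y_d` on `R^d`. -/
def dotp {R : Type*} [Ring R] {d : ℕ} (y x : Fin d → R) : R := ∑ i, y i * x i

/-- A lower bound for the finite Euler product `∏ (1 - x ^ k)` when `x ≤ 1 / 2`. -/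
theorem quarter_add_le_prod_one_sub_pow {x : ℝ} (h0 : 0 ≤ x) (hx : x ≤ 1 / 2) {n : ℕ}
    (hn : 1 ≤ n) :
    1 / 4 + (1 / 2) ^ (n + 1) ≤ ∏ i ∈ range n, (1 - x ^ (i + 1)) := by
  induction n, hn using Nat.le_induction with
  | base => norm_num; linarith
  | succ n hn ih =>
    rw [prod_range_succ]
    have hpow : x ^ (n + 1) ≤ (1 / 2) ^ (n + 1) := pow_le_pow_left₀ h0 hx _
    have hsmall : (1 / 2 : ℝ) ^ (n + 1) ≤ (1 / 2) ^ 2 :=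
      pow_le_pow_of_le_one (by norm_num) (by norm_num) (by lia)
    have hpos : (0 : ℝ) < (1 / 2) ^ (n + 1) := by positivity
    rw [pow_succ (1 / 2 : ℝ) (n + 1)]
    set a : ℝ := (1 / 2) ^ (n + 1)
    calc 1 / 4 + a * (1 / 2) ≤ (1 / 4 + a) * (1 - a) := by nlinarith
      _ ≤ _ := mul_le_mul ih (by linarith) (by linarith) (by linarith)

/-- At least a quarter of the square matrices over a finite field are invertible. -/
theorem quarter_card_matrix_le_card_GL {F : Type*} [Field F] [Fintype F] {n : ℕ} (hn : 1 ≤ n) :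
    (1 / 4) * (Nat.card (Matrix (Fin n) (Fin n) F) : ℝ) ≤
      Nat.card (Matrix (Fin n) (Fin n) F)ˣ := by
  have hq : (2 : ℝ) ≤ Fintype.card F := by exact_mod_cast Fintype.one_lt_card (α := F)
  have hGL : (Nat.card (Matrix (Fin n) (Fin n) F)ˣ : ℝ) =
      ∏ i ∈ range n, ((Fintype.card F : ℝ) ^ n - (Fintype.card F : ℝ) ^ i) := by
    have h := Matrix.card_GL_field (𝔽 := F) n
    rw [Fin.prod_univ_eq_prod_range (fun i => Fintype.card F ^ n - Fintype.card F ^ i) n] at h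
    have h' : Nat.card (Matrix (Fin n) (Fin n) F)ˣ =
        ∏ i ∈ range n, (Fintype.card F ^ n - Fintype.card F ^ i) := by
      convert h
    rw [h', Nat.cast_prod]
    refine prod_congr rfl fun i hi => ?_
    rw [Nat.cast_sub (Nat.pow_le_pow_right Fintype.card_pos (mem_range.mp hi).le)]
    push_cast
    rfl
  have hM : (Nat.card (Matrix (Fin n) (Fin n) F) : ℝ) =
      ∏ _i ∈ range n, (Fintype.card F : ℝ) ^ n := by
    simp [Matrix, Nat.card_eq_fintype_card]
  generalize (Fintype.card F : ℝ) = q at hq hGL hM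
  have hq_pos : 0 < q := by linarith
  have hfactor : ∏ i ∈ range n, (q ^ n - q ^ i) =
      (∏ _i ∈ range n, q ^ n) * ∏ i ∈ range n, (1 - q⁻¹ ^ (i + 1)) := by
    rw [← prod_range_reflect (fun i => 1 - q⁻¹ ^ (i + 1)), ← prod_mul_distrib]
    refine prod_congr rfl fun i hi => ?_
    have hi := mem_range.mp hi
    have hsplit : q ^ n = q ^ i * q ^ (n - 1 - i + 1) := by
      rw [← pow_add]; congr 1; lia
    rw [mul_sub, mul_one, inv_pow]
    nth_rewrite 3 [hsplit]
    field_simp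
  have hprod := quarter_add_le_prod_one_sub_pow (x := q⁻¹) (by positivity)
    (by rw [one_div]; exact inv_anti₀ (by norm_num) hq) hn
  have hpow : (0 : ℝ) < (1 / 2) ^ (n + 1) := by positivity
  rw [hGL, hM, hfactor, mul_comm]
  exact mul_le_mul_of_nonneg_left (by linarith) (by positivity)

/-- Pairs of vectors whose first entry on the left is a unit give many solutions of
`x·y = t`. -/
theorem card_units_mul_pow_le_card_dotp_eq {R : Type*} [Ring R] [Finite R] (d : ℕ) (t : R) :
    Nat.card Rˣ * Nat.card R ^ (2 * d) ≤
      Nat.card {p : (Fin (d + 1) → R) × (Fin (d + 1) → R) // dotp p.1 p.2 = t} := by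
  let f : Rˣ × (Fin d → R) × (Fin d → R) →
      {p : (Fin (d + 1) → R) × (Fin (d + 1) → R) // dotp p.1 p.2 = t} := fun s =>
    ⟨(Fin.cons (s.1 : R) s.2.1, Fin.cons (↑s.1⁻¹ * (t - dotp s.2.1 s.2.2)) s.2.2), by
      simp [dotp, Fin.sum_univ_succ]⟩
  have hf : Function.Injective f := by
    rintro ⟨u, a, b⟩ ⟨v, a', b'⟩ h
    simp only [f, Subtype.mk.injEq, Prod.mk.injEq, Fin.cons_inj] at h
    obtain ⟨⟨hu, ha⟩, -, hb⟩ := h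
    rw [Units.ext hu, ha, hb]
  have h := Nat.card_le_card_of_injective f hf
  simpa [Nat.card_prod, Nat.card_fun, ← pow_add, ← two_mul] using h

/-- for `R = Mat_{n×n}(𝔽_q)` and a unit `t ∈ R`,
`#{(x,y) ∈ R^d × R^d : x·y = t} ≥ (1/4)·|R|^{2d−1}`. -/
theorem stmt6 {F : Type*} [Field F] [Fintype F] (q : ℕ) (hq : q = Fintype.card F)
    (n d : ℕ) (hn : 1 ≤ n) (hd : 1 ≤ d) (t : (Matrix (Fin n) (Fin n) F)ˣ) :
    (Nat.card {p : (Fin d → Matrix (Fin n) (Fin n) F) × (Fin d → Matrix (Fin n) (Fin n) F) //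
        dotp p.1 p.2 = (t : Matrix (Fin n) (Fin n) F)} : ℝ) ≥
      (1 / 4) * (Fintype.card (Matrix (Fin n) (Fin n) F) : ℝ) ^ (2 * d - 1) := by
  obtain ⟨e, rfl⟩ := Nat.exists_eq_add_of_le' hd
  have hcount := card_units_mul_pow_le_card_dotp_eq e (t : Matrix (Fin n) (Fin n) F)
  have hGL := quarter_card_matrix_le_card_GL (F := F) hn
  rw [ge_iff_le, ← Nat.card_eq_fintype_card, show 2 * (e + 1) - 1 = 2 * e + 1 by lia, pow_succ']
  calc _ = (1 / 4 * (Nat.card (Matrix (Fin n) (Fin n) F) : ℝ)) *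
        (Nat.card (Matrix (Fin n) (Fin n) F) : ℝ) ^ (2 * e) := by ring
    _ ≤ (Nat.card (Matrix (Fin n) (Fin n) F)ˣ : ℝ) *
        (Nat.card (Matrix (Fin n) (Fin n) F) : ℝ) ^ (2 * e) := by gcongr
    _ ≤ _ := by exact_mod_cast hcount
end

section
/- Let q be a prime power and d ≥ 1 an integer. If E ⊆ 𝔽_q^d satisfies |E| > (2√2 / (1 − q^{−d}))·q^{(d+1)/2}, then for every nonzero t ∈ 𝔽_q there exist x, y ∈ E with x·y = t; that is, E·E ⊇ 𝔽_q^×. -/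
open Finset
open scoped Classical

section DotProductCounting

variable {F ι : Type*} [Field F] [Fintype ι]

theorem exists_dotProduct_eq_one {y : ι → F} (hy : y ≠ 0) : ∃ w : ι → F, w ⬝ᵥ y = 1 := by
  obtain ⟨i, hi⟩ := Function.ne_iff.mp hy
  exact ⟨Pi.single i (y i)⁻¹, by rw [single_dotProduct]; exact inv_mul_cancel₀ hi⟩

variable [Fintype F]

/-- An affine hyperplane of `F^ι` has `q^(|ι| - 1)` points. -/
theorem card_dotProduct_eq_mul_card {y : ι → F} (hy : y ≠ 0) (t : F) :
    #{x : ι → F | x ⬝ᵥ y = t} * Fintype.card F = Fintype.card (ι → F) := by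
  obtain ⟨w, hw⟩ := exists_dotProduct_eq_one hy
  rw [← card_univ, ← card_univ (α := ι → F), ← card_product]
  refine card_nbij' (fun p => p.1 + p.2 • w)
    (fun x => (x + (t - x ⬝ᵥ y) • w, x ⬝ᵥ y - t)) ?_ ?_ ?_ ?_
  · simp
  · intro x _
    simp [add_dotProduct, hw]
  · rintro ⟨x, a⟩ hx
    have hx' : x ⬝ᵥ y = t := by simpa using hx
    ext <;> simp [add_dotProduct, hw, hx']
  · intro x _
    ext
    simp
    ring

/-- Two affine hyperplanes `x·y = t` and `x·z = t` with `y ≠ z` and `t ≠ 0` meet in at most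
`q^(|ι| - 2)` points. -/
theorem card_dotProduct_eq_and_eq_mul_card_sq_le {y z : ι → F} (hyz : y ≠ z) {t : F}
    (ht : t ≠ 0) :
    #{x : ι → F | x ⬝ᵥ y = t ∧ x ⬝ᵥ z = t} * Fintype.card F ^ 2 ≤ Fintype.card (ι → F) := by
  rcases eq_empty_or_nonempty ({x : ι → F | x ⬝ᵥ y = t ∧ x ⬝ᵥ z = t} : Finset _) with h | ⟨u, hu⟩
  · simp [h]
  · obtain ⟨huy, huz⟩ : u ⬝ᵥ y = t ∧ u ⬝ᵥ z = t := by simpa using hu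
    obtain ⟨w, hw⟩ := exists_dotProduct_eq_one (sub_ne_zero.mpr hyz)
    rw [dotProduct_sub] at hw
    rw [sq, ← card_univ, ← card_univ (α := ι → F), ← card_product, ← card_product]
    refine card_le_card_of_injOn
      (fun p => p.1 + (p.2.1 • u + p.2.2 • w)) (by simp) ?_
    rintro ⟨x, a, b⟩ hx ⟨x', a', b'⟩ hx' h
    obtain ⟨hxy, hxz⟩ : x ⬝ᵥ y = t ∧ x ⬝ᵥ z = t := by simpa using hx
    obtain ⟨hxy', hxz'⟩ : x' ⬝ᵥ y = t ∧ x' ⬝ᵥ z = t := by simpa using hx'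
    have hy := congrArg (· ⬝ᵥ y) h
    have hz := congrArg (· ⬝ᵥ z) h
    simp only [add_dotProduct, smul_dotProduct, smul_eq_mul, hxy, hxz, hxy', hxz', huy, huz]
      at hy hz
    have hb : b = b' := by linear_combination hy - hz - (b - b') * hw
    subst hb
    have ha : a = a' := mul_right_cancel₀ ht (by linear_combination hy)
    subst ha
    simpa using h

/-- A set of nonzero vectors with no two (possibly equal) members of dot product `t ≠ 0` has at
most `q^((|ι| + 1) / 2)` elements. -/
theorem card_sq_le_of_forall_dotProduct_ne {A : Finset (ι → F)} (hA : ∀ y ∈ A, y ≠ 0) {t : F}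
    (ht : t ≠ 0) (h : ∀ x ∈ A, ∀ y ∈ A, x ⬝ᵥ y ≠ t) :
    #A ^ 2 ≤ Fintype.card (ι → F) * Fintype.card F := by
  rcases A.eq_empty_or_nonempty with rfl | hne
  · simp
  have hn : (0 : ℝ) < #A := by exact_mod_cast hne.card_pos
  set n : ℝ := ((#A : ℕ) : ℝ) with hn_def
  set q : ℝ := (Fintype.card F : ℝ)
  set Q : ℝ := (Fintype.card (ι → F) : ℝ)
  let N : (ι → F) → ℝ := fun x => ∑ y ∈ A, if x ⬝ᵥ y = t then 1 else 0
  have hyperplane : ∀ y ∈ A, (#{x : ι → F | x ⬝ᵥ y = t} : ℝ) * q = Q := fun y hy => by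
    simp only [q, Q]
    exact_mod_cast card_dotProduct_eq_mul_card (hA y hy) t
  have first_moment : (∑ x, N x) * q = n * Q := by
    rw [sum_comm, sum_mul, hn_def, ← nsmul_eq_mul]
    refine sum_eq_card_nsmul fun y hy => ?_
    rw [sum_boole]
    exact hyperplane y hy
  have second_moment : (∑ x, N x ^ 2) * q ^ 2 ≤ n ^ 2 * Q + n * (Q * q) := by
    have expand : ∑ x, N x ^ 2 =
        ∑ y ∈ A, ∑ z ∈ A, (#{x : ι → F | x ⬝ᵥ y = t ∧ x ⬝ᵥ z = t} : ℝ) := by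
      simp only [N, sq, sum_mul_sum]
      rw [sum_comm]
      refine sum_congr rfl fun y _ => ?_
      rw [sum_comm]
      refine sum_congr rfl fun z _ => ?_
      simp only [← ite_and, mul_ite, mul_one, mul_zero, ← sum_boole]
      refine sum_congr rfl fun x _ => ?_
      simp only [and_comm]
    have bound : ∀ y ∈ A, ∀ z ∈ A,
        (#{x : ι → F | x ⬝ᵥ y = t ∧ x ⬝ᵥ z = t} : ℝ) * q ^ 2 ≤
          Q + if y = z then Q * q else 0 := by
      intro y hy z _
      split_ifs with hyz
      · subst hyz
        have hQ : 0 ≤ Q := Nat.cast_nonneg _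
        simp only [and_self]
        rw [sq, ← mul_assoc, hyperplane y hy]
        linarith
      · simp only [add_zero, q, Q]
        exact_mod_cast card_dotProduct_eq_and_eq_mul_card_sq_le hyz ht
    calc (∑ x, N x ^ 2) * q ^ 2
        = ∑ y ∈ A, ∑ z ∈ A, (#{x : ι → F | x ⬝ᵥ y = t ∧ x ⬝ᵥ z = t} : ℝ) * q ^ 2 := by
          simp only [expand, sum_mul]
      _ ≤ ∑ y ∈ A, ∑ z ∈ A, (Q + if y = z then Q * q else 0) :=
          sum_le_sum fun y hy => sum_le_sum fun z hz => bound y hy z hz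
      _ = n ^ 2 * Q + n * (Q * q) := by
          simp [sum_add_distrib, ← hn_def, sum_ite_mem]
          ring
  have variance_lower : n * n ^ 2 ≤ ∑ x, (q * N x - n) ^ 2 := by
    calc n * n ^ 2 = ∑ x ∈ A, (q * N x - n) ^ 2 := by
          rw [hn_def, ← nsmul_eq_mul]
          refine (sum_eq_card_nsmul fun x hx => ?_).symm
          have hN : N x = 0 := sum_eq_zero fun y hy => if_neg (h x hx y hy)
          simp [hN]
      _ ≤ ∑ x, (q * N x - n) ^ 2 :=
          sum_le_sum_of_subset_of_nonneg (subset_univ _) fun _ _ _ => sq_nonneg _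
  have variance_eq : ∑ x, (q * N x - n) ^ 2 =
      (∑ x, N x ^ 2) * q ^ 2 - 2 * n * ((∑ x, N x) * q) + Q * n ^ 2 := by
    have hconst : ∑ _x : ι → F, n ^ 2 = Q * n ^ 2 := by
      rw [sum_const, card_univ, nsmul_eq_mul]
    rw [← hconst, sum_mul, sum_mul, mul_sum, ← sum_sub_distrib, ← sum_add_distrib]
    exact sum_congr rfl fun x _ => by ring
  have key : n * n ^ 2 ≤ n * (Q * q) := by
    rw [variance_eq, first_moment] at variance_lower
    linarith
  have := le_of_mul_le_mul_left key hn
  simp only [n, q, Q] at this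
  exact_mod_cast this

end DotProductCounting

/-- over `𝔽_q`, if `E ⊆ 𝔽_q^d` satisfies
`|E| > (2√2/(1 − q^{−d}))·q^{(d+1)/2}`, then `E·E ⊇ 𝔽_q^×`: for every `t ≠ 0` there are
`x, y ∈ E` with `x·y = t`. -/
theorem stmt7 {F : Type*} [Field F] [Fintype F] (q : ℕ) (hq : q = Fintype.card F)
    (d : ℕ) (hd : 1 ≤ d) (E : Finset (Fin d → F))
    (hE : (E.card : ℝ) >
      (2 * Real.sqrt 2 / (1 - (q : ℝ) ^ (-(d : ℝ)))) * (q : ℝ) ^ (((d : ℝ) + 1) / 2)) :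
    ∀ t : F, t ≠ 0 → ∃ x ∈ E, ∃ y ∈ E, dotp x y = t := by
  intro t ht
  by_contra! hcon
  have hbound : #(E.erase 0) ^ 2 ≤ q ^ (d + 1) := by
    have := card_sq_le_of_forall_dotProduct_ne (A := E.erase 0)
      (fun y hy => ne_of_mem_erase hy) ht
      (fun x hx y hy => hcon x (mem_of_mem_erase hx) y (mem_of_mem_erase hy))
    simpa [hq, pow_succ] using this
  have hq1 : (1 : ℝ) < q := by
    rw [hq]
    exact_mod_cast Fintype.one_lt_card
  set r : ℝ := (q : ℝ) ^ (((d : ℝ) + 1) / 2) with hr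
  have hr1 : 1 ≤ r := Real.one_le_rpow hq1.le (by positivity)
  have hr2 : r ^ 2 = (q : ℝ) ^ (d + 1) := by
    rw [hr, ← Real.rpow_natCast, ← Real.rpow_mul (by positivity), ← Real.rpow_natCast]
    congr 1
    push_cast
    ring
  have herase : (#(E.erase 0) : ℝ) ≤ r := by
    refine le_of_sq_le_sq ?_ (by positivity)
    rw [hr2]
    exact_mod_cast hbound
  have hcard : (#E : ℝ) ≤ #(E.erase 0) + 1 := by
    have := pred_card_le_card_erase (s := E) (a := 0)
    exact_mod_cast Nat.sub_le_iff_le_add.mp this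
  have hsqrt : 1 ≤ √(2 : ℝ) := Real.one_le_sqrt.mpr one_le_two
  have hconst : 2 ≤ 2 * √2 / (1 - (q : ℝ) ^ (-(d : ℝ))) := by
    have hpos : 0 < (q : ℝ) ^ (-(d : ℝ)) := by positivity
    have hlt : (q : ℝ) ^ (-(d : ℝ)) < 1 :=
      Real.rpow_lt_one_of_one_lt_of_neg hq1 (by simp; omega)
    rw [le_div_iff₀ (by linarith)]
    linarith
  have := mul_le_mul_of_nonneg_right hconst (zero_le_one.trans hr1)
  linarith
end

section
/- Let R be a finite unital ring (possibly noncommutative), d ≥ 1 an integer, t ∈ R a unit, and C₁ > 0 a constant. Suppose that every subset E ⊆ R^d with |E| > C₁·|R|^{(d+1)/2} contains elements x, y ∈ E with x·y = t. Then every proper left ideal I of R, and every proper right ideal I of R, satisfies |I| ≤ C₁^{1/d}·|R|^{1/2 + 1/(2d)}. -/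
open Finset
open scoped Classical

/-- A proper one-sided ideal contains no unit. -/
theorem not_mem_of_isUnit_of_proper {R : Type*} [Ring R] {I : AddSubgroup R} {t : R}
    (ht : IsUnit t) (hproper : (I : Set R) ≠ Set.univ)
    (hideal : (∀ r ∈ I, ∀ s : R, s * r ∈ I) ∨ (∀ r ∈ I, ∀ s : R, r * s ∈ I)) : t ∉ I := by
  obtain ⟨u, rfl⟩ := ht
  refine fun hu => hproper (Set.eq_univ_of_forall fun a => ?_)
  rcases hideal with h | h
  · simpa [mul_assoc] using h u hu (a * ↑u⁻¹)
  · simpa using h u hu (↑u⁻¹ * a)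

/-- The dot product of two vectors with entries in a one-sided ideal lies in the ideal. -/
theorem dotp_mem {R : Type*} [Ring R] {d : ℕ} {I : AddSubgroup R} {x y : Fin d → R}
    (hideal : (∀ r ∈ I, ∀ s : R, s * r ∈ I) ∨ (∀ r ∈ I, ∀ s : R, r * s ∈ I))
    (hx : ∀ i, x i ∈ I) (hy : ∀ i, y i ∈ I) : dotp x y ∈ I :=
  sum_mem fun i _ => hideal.elim (fun h => h _ (hy i) _) (fun h => h _ (hx i) _)

/-- if every `E ⊆ R^d` with `|E| > C₁·|R|^{(d+1)/2}` contains `x, y` with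
`x·y = t` (`t` a unit), then every proper left ideal and every proper right ideal `I` of `R`
satisfies `|I| ≤ C₁^{1/d}·|R|^{1/2+1/(2d)}`. -/
theorem stmt9 {R : Type*} [Ring R] [Fintype R] (d : ℕ) (hd : 1 ≤ d)
    (t : R) (ht : IsUnit t) (C₁ : ℝ) (hC₁ : 0 < C₁)
    (hSolv : ∀ E : Finset (Fin d → R),
      (E.card : ℝ) > C₁ * (Fintype.card R : ℝ) ^ (((d : ℝ) + 1) / 2) →
      ∃ x ∈ E, ∃ y ∈ E, dotp x y = t)
    (I : AddSubgroup R)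
    (hproper : (I : Set R) ≠ Set.univ)
    (hideal : (∀ r ∈ I, ∀ s : R, s * r ∈ I) ∨ (∀ r ∈ I, ∀ s : R, r * s ∈ I)) :
    (Nat.card I : ℝ) ≤
      C₁ ^ ((1 : ℝ) / d) * (Fintype.card R : ℝ) ^ ((1 : ℝ) / 2 + 1 / (2 * (d : ℝ))) := by
  by_contra! hlt
  have hd0 : (d : ℝ) ≠ 0 := by positivity
  have hpow : (C₁ ^ ((1 : ℝ) / d) *
      (Fintype.card R : ℝ) ^ ((1 : ℝ) / 2 + 1 / (2 * (d : ℝ)))) ^ d =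
      C₁ * (Fintype.card R : ℝ) ^ (((d : ℝ) + 1) / 2) := by
    rw [mul_pow, ← Real.rpow_mul_natCast hC₁.le, ← Real.rpow_mul_natCast (Nat.cast_nonneg _),
      one_div_mul_cancel hd0, Real.rpow_one]
    congr 2
    field_simp
  have hcard : (Fintype.piFinset fun _ : Fin d => univ.filter (· ∈ I)).card = Nat.card I ^ d := by
    rw [Fintype.card_piFinset_const, Nat.card_eq_fintype_card, Fintype.card_subtype]
  obtain ⟨x, hx, y, hy, hxy⟩ := hSolv (Fintype.piFinset fun _ => univ.filter (· ∈ I)) (by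
    rw [hcard, ← hpow, Nat.cast_pow]
    exact pow_lt_pow_left₀ hlt (by positivity) (by omega))
  simp only [Fintype.mem_piFinset, mem_filter, mem_univ, true_and] at hx hy
  exact not_mem_of_isUnit_of_proper ht hproper hideal (hxy ▸ dotp_mem hideal hx hy)
end

section
/- Let R be a finite unital ring with Jacobson radical J, let d ≥ 1 be an integer, let t ∈ R be a unit, and let x ∈ R^d. Suppose ỹ ∈ (R/J)^d satisfies ỹ·x̃ = t̃, where x̃ ∈ (R/J)^d and t̃ ∈ R/J are the coordinatewise reductions of x and t modulo J. Then there exists y ∈ R^d such that y ≡ ỹ (mod J) coordinatewise and y·x = t. -/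
open Finset
open scoped Classical

/-- In a finite ring, `1 + r` is a unit for every `r` in the Jacobson radical. -/
theorem isUnit_one_add_of_mem_jacobson_bot {R : Type*} [Ring R] [Finite R] {r : R}
    (hr : r ∈ (⊥ : TwoSidedIdeal R).jacobson) : IsUnit (1 + r) := by
  obtain ⟨z, hz⟩ := TwoSidedIdeal.mem_jacobson_iff.mp hr 1
  have hz' : z * 1 * r + z - 1 = 0 := by simpa using hz
  have hinv : z * (1 + r) = 1 := by
    rw [← sub_eq_zero, ← hz']
    noncomm_ring
  exact IsUnit.of_mul_eq_one_right z hinv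

/-- let `J` be the Jacobson radical of the finite ring `R` and let
`π : R → S ≅ R/J` be the quotient map (`S` a finite ring, `π` surjective with kernel `J`).
If `t ∈ R` is a unit, `x ∈ R^d`, and `ỹ ∈ (R/J)^d` satisfies `ỹ·x̃ = t̃`, then there is a
`y ∈ R^d` with `y ≡ ỹ (mod J)` coordinatewise and `y·x = t`. -/
theorem stmt17 {R S : Type*} [Ring R] [Fintype R] [Ring S] [Fintype S]
    (π : R →+* S) (hsurj : Function.Surjective π)
    (hker : ∀ r : R, π r = 0 ↔ r ∈ (⊥ : TwoSidedIdeal R).jacobson)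
    (d : ℕ) (hd : 1 ≤ d) (t : R) (ht : IsUnit t)
    (x : Fin d → R) (yt : Fin d → S)
    (hyt : dotp yt (fun i => π (x i)) = π t) :
    ∃ y : Fin d → R, (∀ i, π (y i) = yt i) ∧ dotp y x = t := by
  obtain ⟨t, rfl⟩ := ht
  choose lift hlift using hsurj
  set y₀ : Fin d → R := fun i => lift (yt i) with hy₀
  have hπ : π (dotp y₀ x) = π t := by
    rw [← hyt]
    simp [dotp, hy₀, hlift]
  have hJ : ↑t⁻¹ * (dotp y₀ x - t) ∈ (⊥ : TwoSidedIdeal R).jacobson := by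
    rw [← hker, map_mul, map_sub, hπ, sub_self, mul_zero]
  have hu : IsUnit (dotp y₀ x) := by
    have h := t.isUnit.mul (isUnit_one_add_of_mem_jacobson_bot hJ)
    rwa [mul_add, mul_one, Units.mul_inv_cancel_left, add_sub_cancel] at h
  obtain ⟨u, hu⟩ := hu
  have hv : π (t * ↑u⁻¹) = 1 := by
    rw [map_mul, ← hπ, ← hu, ← map_mul, Units.mul_inv, map_one]
  refine ⟨fun i => t * ↑u⁻¹ * y₀ i, fun i => ?_, ?_⟩
  · rw [map_mul, hv, one_mul, hy₀, hlift]
  · have hmul : dotp (fun i => t * ↑u⁻¹ * y₀ i) x = t * ↑u⁻¹ * dotp y₀ x := by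
      simp only [dotp, Finset.mul_sum, mul_assoc]
    rw [hmul, ← hu, Units.inv_mul_cancel_right]
end
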